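/- Let X₁,…,X_{n+1} be i.i.d. N_p(μ, Σ) with Σ positive definite and p ≤ n, and let T̂ = log det Σ̂ − τ_{n,p}. Then T̂ is an unbiased estimator of log det Σ and its mean squared error equals exactly E(T̂ − log det Σ)² = ∑_{k=1}^p ψ'((n−k+1)/2), where ψ' is the trigamma function (the second derivative of log Γ). -/

import Mathlib

open MeasureTheory ProbabilityTheory Filter Matrix

/-- The digamma function `ψ(x) = d/dx log Γ(x)`. -/
noncomputable def digamma (x : ℝ) : ℝ := deriv (fun y : ℝ => Real.log (Real.Gamma y)) x

/-- The trigamma function `ψ'(x)`, the derivative of the digamma function. -/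
noncomputable def trigamma (x : ℝ) : ℝ := deriv digamma x

/-- The centering constant `τ_{n,p} = ∑_{k=1}^p [ψ((n−k+1)/2) − log(n/2)]`. -/
noncomputable def tauNP (n p : ℕ) : ℝ :=
  ∑ k ∈ Finset.Icc 1 p, (digamma (((n : ℝ) - k + 1) / 2) - Real.log ((n : ℝ) / 2))

/-- `ν` is the multivariate Gaussian distribution `N_p(m, S)` on `ℝ^p`: it is a probability
measure and the pushforward under any linear functional `x ↦ ⟨l, x⟩` is the univariate
Gaussian with mean `⟨l, m⟩` and variance `lᵀ S l`. -/
def IsMvGaussian {p : ℕ} (m : Fin p → ℝ) (S : Matrix (Fin p) (Fin p) ℝ)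
    (ν : Measure (Fin p → ℝ)) : Prop :=
  IsProbabilityMeasure ν ∧
    ∀ l : Fin p → ℝ,
      ν.map (fun x => ∑ i, l i * x i) =
        gaussianReal (∑ i, l i * m i) (Real.toNNReal (l ⬝ᵥ (S *ᵥ l)))

/-- The sample covariance matrix `Σ̂` based on the `n+1` observations `X 0, …, X n`. -/
noncomputable def sampleCov {n p : ℕ} (X : Fin (n + 1) → Fin p → ℝ) :
    Matrix (Fin p) (Fin p) ℝ :=
  Matrix.of fun i j =>
    (1 / (n : ℝ)) * ∑ k, (X k i - (∑ l, X l i) / (n + 1)) * (X k j - (∑ l, X l j) / (n + 1))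

section GramDeterminant

open scoped ENNReal MatrixOrder

section GaussianNorm

variable {E : Type*} [NormedAddCommGroup E] [InnerProductSpace ℝ E] [FiniteDimensional ℝ E]
  [MeasurableSpace E] [BorelSpace E]

theorem stdGaussian_eq_withDensity :
    stdGaussian E = volume.withDensity fun x : E =>
      ENNReal.ofReal ((2 * Real.pi) ^ (-(Module.finrank ℝ E : ℝ) / 2) *
        Real.exp (-(1 / 2) * ‖x‖ ^ 2)) := by
  have hpi : (0 : ℝ) < 2 * Real.pi := by positivity
  have hexp : Integrable (fun x : E => Real.exp (-(1 / 2) * ‖x‖ ^ 2)) := by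
    refine not_imp_comm.1 integral_undef ?_
    rw [GaussianFourier.integral_rexp_neg_mul_sq_norm (by norm_num)]
    positivity
  have hfin : IsFiniteMeasure (volume.withDensity fun x : E =>
      ENNReal.ofReal ((2 * Real.pi) ^ (-(Module.finrank ℝ E : ℝ) / 2) *
        Real.exp (-(1 / 2) * ‖x‖ ^ 2))) :=
    isFiniteMeasure_withDensity_ofReal (hexp.const_mul _).2
  refine Measure.ext_of_charFun (E := E) ?_
  ext t
  rw [charFun_stdGaussian, charFun_apply,
    integral_withDensity_eq_integral_toReal_smul₀ (by fun_prop) (by simp)]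
  have h := GaussianFourier.integral_cexp_neg_mul_sq_norm_add (V := E) (b := 1 / 2)
    (by norm_num) Complex.I t
  calc _ = ((2 * Real.pi : ℝ) : ℂ) ^ (-(Module.finrank ℝ E : ℂ) / 2) *
        ∫ v : E, Complex.exp (-(1 / 2) * ‖v‖ ^ 2 + Complex.I * (inner ℝ t v : ℝ)) := by
        rw [h]
        have h1 : (Real.pi : ℂ) / (1 / 2) = ((2 * Real.pi : ℝ) : ℂ) := by push_cast; ring
        rw [h1, ← mul_assoc, ← Complex.cpow_add _ _ (by exact_mod_cast hpi.ne')]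
        ring_nf
        simp [div_eq_mul_inv]
      _ = _ := by
        rw [← integral_const_mul]
        congr 1 with v
        rw [ENNReal.toReal_ofReal (by positivity), Complex.real_smul, Complex.exp_add]
        push_cast
        rw [Complex.ofReal_cpow hpi.le, real_inner_comm]
        push_cast
        ring_nf

theorem stdGaussian_ae_ne_zero [Nontrivial E] : ∀ᵐ x ∂stdGaussian E, x ≠ 0 := by
  rw [stdGaussian_eq_withDensity]
  exact (withDensity_absolutelyContinuous _ _).ae_le (Measure.ae_ne _ _)

/-- The `s`-th moment of the chi-square distribution with `d` degrees of freedom. -/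
noncomputable def chiSqMoment (d : ℕ) (s : ℝ) : ℝ :=
  2 ^ s * Real.Gamma ((d : ℝ) / 2 + s) / Real.Gamma ((d : ℝ) / 2)

theorem chiSqMoment_pos {d : ℕ} {s : ℝ} (hd : 1 ≤ d) (hs : -(1 / 2) < s) :
    0 < chiSqMoment d s := by
  have hd' : (1 : ℝ) ≤ d := by exact_mod_cast hd
  have h1 := Real.Gamma_pos_of_pos (show 0 < (d : ℝ) / 2 + s by linarith)
  have h2 := Real.Gamma_pos_of_pos (show 0 < (d : ℝ) / 2 by linarith)
  unfold chiSqMoment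
  positivity

theorem integral_norm_rpow_stdGaussian_aux [Nontrivial E] {s : ℝ} (hs : -(1 / 2) < s) :
    ∫ x, ‖x‖ ^ (2 * s) ∂stdGaussian E =
      (2 * Real.pi) ^ (-(Module.finrank ℝ E : ℝ) / 2) *
      (Module.finrank ℝ E * volume.real (Metric.ball (0 : E) 1)) *
      ((1 / 2) ^ (-((Module.finrank ℝ E : ℝ) / 2 + s)) * (1 / 2) *
        Real.Gamma ((Module.finrank ℝ E : ℝ) / 2 + s)) := by
  have hd : 1 ≤ Module.finrank ℝ E := Module.finrank_pos
  have hd' : (1 : ℝ) ≤ Module.finrank ℝ E := by exact_mod_cast hd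
  rw [stdGaussian_eq_withDensity,
    integral_withDensity_eq_integral_toReal_smul₀ (by fun_prop) (by simp)]
  have h := integral_fun_norm_addHaar (volume : Measure E)
    (fun r => Real.exp (-(1 / 2) * r ^ 2) * r ^ (2 * s))
  have h2 := integral_rpow_mul_exp_neg_mul_rpow (p := 2) (b := 1 / 2)
    (q := (Module.finrank ℝ E : ℝ) - 1 + 2 * s) (by norm_num) (by linarith) (by norm_num)
  rw [neg_div] at h2
  calc _ = (2 * Real.pi) ^ (-(Module.finrank ℝ E : ℝ) / 2) *
        ∫ x : E, Real.exp (-(1 / 2) * ‖x‖ ^ 2) * ‖x‖ ^ (2 * s) := by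
        rw [← integral_const_mul]
        congr 1 with v
        rw [ENNReal.toReal_ofReal (by positivity), smul_eq_mul, mul_assoc]
      _ = _ := by
        rw [h, nsmul_eq_mul, smul_eq_mul, mul_assoc _ (_ * _), mul_assoc (Module.finrank ℝ E : ℝ)]
        congr 3
        rw [show (Module.finrank ℝ E : ℝ) / 2 + s
          = ((Module.finrank ℝ E : ℝ) - 1 + 2 * s + 1) / 2 by ring, ← h2]
        refine setIntegral_congr_fun measurableSet_Ioi fun y hy => ?_
        have hy : 0 < y := hy
        simp only [smul_eq_mul]
        rw [Real.rpow_add hy, ← Real.rpow_natCast y (_ - 1), Nat.cast_sub hd]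
        simp only [Nat.cast_one, Real.rpow_two]
        ring

theorem integral_norm_rpow_stdGaussian [Nontrivial E] {s : ℝ} (hs : -(1 / 2) < s) :
    ∫ x, ‖x‖ ^ (2 * s) ∂stdGaussian E = chiSqMoment (Module.finrank ℝ E) s := by
  have hd : 0 < Module.finrank ℝ E := Module.finrank_pos
  have hG := Real.Gamma_pos_of_pos (show 0 < (Module.finrank ℝ E : ℝ) / 2 by positivity)
  have h0 := integral_norm_rpow_stdGaussian_aux (E := E) (s := 0) (by norm_num)
  rw [integral_norm_rpow_stdGaussian_aux hs, chiSqMoment]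
  simp only [mul_zero, Real.rpow_zero, integral_const, probReal_univ, smul_eq_mul, mul_one,
    add_zero] at h0
  rw [neg_add, Real.rpow_add (by norm_num), Real.rpow_neg (x := 1 / 2) (by norm_num) s,
    one_div, Real.inv_rpow (by norm_num) s, inv_inv, eq_div_iff hG.ne']
  rw [one_div] at h0
  linear_combination -(2 ^ s * Real.Gamma ((Module.finrank ℝ E : ℝ) / 2 + s)) * h0

theorem lintegral_normSq_rpow_stdGaussian [Nontrivial E] {s : ℝ} (hs : -(1 / 2) < s) :
    ∫⁻ x, ENNReal.ofReal (‖x‖ ^ 2) ^ s ∂stdGaussian E =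
      ENNReal.ofReal (chiSqMoment (Module.finrank ℝ E) s) := by
  have hexp : Integrable (fun x : E => ‖x‖ ^ (2 * s)) (stdGaussian E) := by
    refine not_imp_comm.1 integral_undef ?_
    rw [integral_norm_rpow_stdGaussian hs]
    exact (chiSqMoment_pos Module.finrank_pos hs).ne'
  rw [← integral_norm_rpow_stdGaussian hs,
    ofReal_integral_eq_lintegral_ofReal hexp (ae_of_all _ fun x => by positivity)]
  refine lintegral_congr_ae ?_
  filter_upwards [stdGaussian_ae_ne_zero (E := E)] with x hx
  have : 0 < ‖x‖ := norm_pos_iff.2 hx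
  rw [ENNReal.ofReal_rpow_of_pos (by positivity), Real.rpow_mul this.le, Real.rpow_two]

end GaussianNorm

section Gram

variable {E : Type*} [NormedAddCommGroup E] [InnerProductSpace ℝ E]

theorem det_gram_cons {p : ℕ} {u : E} (hu : u ≠ 0) (v : Fin p → E) :
    (gram ℝ (Fin.cons u v : Fin (p + 1) → E)).det =
      ‖u‖ ^ 2 * (gram ℝ fun j => (Submodule.span ℝ {u})ᗮ.orthogonalProjectionOnto (v j)).det := by
  have hu' : ‖u‖ ^ 2 ≠ 0 := by positivity
  rw [← det_eq_of_forall_row_eq_smul_add_const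
    (A := Matrix.of fun i j => (gram ℝ (Fin.cons u v : Fin (p + 1) → E)) i j +
      (Fin.cons 0 (fun i => -(inner ℝ (v i) u / ‖u‖ ^ 2)) : Fin (p + 1) → ℝ) i *
        (gram ℝ (Fin.cons u v : Fin (p + 1) → E)) 0 j)
    (Fin.cons 0 (fun i => -(inner ℝ (v i) u / ‖u‖ ^ 2))) 0 (by simp) (fun i j => rfl),
    det_succ_column_zero, Fin.sum_univ_succ, Finset.sum_eq_zero]
  · simp only [of_apply, gram_apply, Fin.cons_zero, real_inner_self_eq_norm_sq, Fin.val_zero,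
      pow_zero, one_mul, zero_mul, add_zero]
    congr 2
    ext i j
    simp only [submatrix_apply, of_apply, gram_apply, Fin.succAbove_zero, Fin.cons_succ,
      Submodule.coe_inner]
    have hP : ∀ w : E, ((Submodule.span ℝ {u})ᗮ.orthogonalProjectionOnto w : E) =
        w - (inner ℝ u w / ‖u‖ ^ 2) • u := fun w => by
      have := Submodule.starProjection_orthogonal_val (K := Submodule.span ℝ {u}) w
      rw [Submodule.starProjection_singleton] at this
      simpa using this
    rw [hP, hP]
    simp only [inner_sub_left, inner_sub_right, inner_smul_left, inner_smul_right,
      real_inner_self_eq_norm_sq, real_inner_comm u]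
    simp
    field_simp
    ring
  · intro i _
    simp only [of_apply, gram_apply, Fin.cons_zero, Fin.cons_succ, real_inner_self_eq_norm_sq]
    field_simp
    ring

theorem continuous_det_gram {p : ℕ} : Continuous fun v : Fin p → E => (gram ℝ v).det := by
  refine Continuous.matrix_det (continuous_matrix fun i j => ?_)
  simp only [gram_apply]
  fun_prop

theorem measurable_ofReal_det_gram_rpow [FiniteDimensional ℝ E] [MeasurableSpace E]
    [BorelSpace E] (p : ℕ) (s : ℝ) :
    Measurable fun v : Fin p → E => ENNReal.ofReal (gram ℝ v).det ^ s :=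
  (ENNReal.measurable_ofReal.comp continuous_det_gram.measurable).pow_const s

theorem stdGaussian_map_orthogonalProjectionOnto [FiniteDimensional ℝ E] [MeasurableSpace E]
    [BorelSpace E] (K : Submodule ℝ E) :
    (stdGaussian E).map K.orthogonalProjectionOnto = stdGaussian K := by
  have : IsProbabilityMeasure ((stdGaussian E).map K.orthogonalProjectionOnto) :=
    Measure.isProbabilityMeasure_map (by fun_prop)
  refine Measure.ext_of_charFun ?_
  ext t
  rw [charFun_stdGaussian, charFun_apply, integral_map (by fun_prop) (by fun_prop)]
  simp only [Submodule.inner_orthogonalProjectionOnto_eq_of_mem_right]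
  rw [← charFun_apply, charFun_stdGaussian, Submodule.coe_norm]

end Gram

theorem lintegral_det_gram_rpow {s : ℝ} (hs : -(1 / 2) < s) (p : ℕ) (E : Type*)
    [NormedAddCommGroup E] [InnerProductSpace ℝ E] [FiniteDimensional ℝ E]
    [MeasurableSpace E] [BorelSpace E] (hp : p ≤ Module.finrank ℝ E) :
    ∫⁻ v, ENNReal.ofReal (gram ℝ v).det ^ s ∂(Measure.pi fun _ : Fin p => stdGaussian E) =
      ENNReal.ofReal (∏ k ∈ Finset.range p, chiSqMoment (Module.finrank ℝ E - k) s) := by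
  induction p generalizing E with
  | zero => simp
  | succ p ih =>
    have : Nontrivial E := Module.nontrivial_of_finrank_pos (R := ℝ) (by omega)
    have hinner : ∀ u : E, u ≠ 0 →
        ∫⁻ v, ENNReal.ofReal (gram ℝ (Fin.cons u v : Fin (p + 1) → E)).det ^ s
          ∂(Measure.pi fun _ : Fin p => stdGaussian E) =
        ENNReal.ofReal (‖u‖ ^ 2) ^ s * ENNReal.ofReal
          (∏ k ∈ Finset.range p, chiSqMoment (Module.finrank ℝ E - (k + 1)) s) := by
      intro u hu
      have hrank : Module.finrank ℝ (Submodule.span ℝ {u})ᗮ = Module.finrank ℝ E - 1 := by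
        have := Submodule.finrank_add_finrank_orthogonal (Submodule.span ℝ {u})
        rw [finrank_span_singleton hu] at this
        omega
      have ih' := ih (Submodule.span ℝ {u})ᗮ (by omega)
      simp only [hrank, Nat.sub_sub, add_comm 1] at ih'
      have hproj : Measurable fun v : Fin p → E => ENNReal.ofReal (gram ℝ fun i =>
          (Submodule.span ℝ {u})ᗮ.orthogonalProjectionOnto (v i)).det ^ s :=
        (measurable_ofReal_det_gram_rpow p s).comp (by fun_prop)
      rw [← ih', ← stdGaussian_map_orthogonalProjectionOnto,
        ← Measure.pi_map_pi (fun _ => by fun_prop),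
        lintegral_map (measurable_ofReal_det_gram_rpow _ _) (by fun_prop),
        ← lintegral_const_mul _ hproj]
      refine lintegral_congr fun v => ?_
      rw [det_gram_cons hu, ENNReal.ofReal_mul (by positivity),
        ENNReal.mul_rpow_of_ne_top ENNReal.ofReal_ne_top ENNReal.ofReal_ne_top]
    have hcons : Measurable fun z : E × (Fin p → E) => ENNReal.ofReal
        (gram ℝ ((MeasurableEquiv.piFinSuccAbove (fun _ : Fin (p + 1) => E) 0).symm z)).det ^ s :=
      (measurable_ofReal_det_gram_rpow (p + 1) s).comp (MeasurableEquiv.measurable _)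
    rw [← (measurePreserving_piFinSuccAbove (fun _ : Fin (p + 1) => stdGaussian E)
        0).symm.lintegral_comp_emb (MeasurableEquiv.measurableEmbedding _),
      lintegral_prod _ hcons.aemeasurable]
    simp only [MeasurableEquiv.piFinSuccAbove_symm_apply, Fin.insertNthEquiv_zero]
    refine (lintegral_congr_ae ((stdGaussian_ae_ne_zero (E := E)).mono hinner)).trans ?_
    rw [lintegral_mul_const' _ _ ENNReal.ofReal_ne_top, lintegral_normSq_rpow_stdGaussian hs,
      ← ENNReal.ofReal_mul (chiSqMoment_pos Module.finrank_pos hs).le, Finset.prod_range_succ',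
      Nat.sub_zero, mul_comm]

theorem det_gram_pos_ae (p : ℕ) (E : Type*) [NormedAddCommGroup E] [InnerProductSpace ℝ E]
    [FiniteDimensional ℝ E] [MeasurableSpace E] [BorelSpace E] (hp : p ≤ Module.finrank ℝ E) :
    ∀ᵐ v ∂(Measure.pi fun _ : Fin p => stdGaussian E), 0 < (gram ℝ v).det := by
  have h := lintegral_det_gram_rpow (s := -(1 / 4)) (by norm_num) p E hp
  filter_upwards [ae_lt_top (measurable_ofReal_det_gram_rpow p _)
    (h ▸ ENNReal.ofReal_ne_top)] with v hv
  contrapose! hv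
  rw [ENNReal.ofReal_of_nonpos hv, ENNReal.zero_rpow_of_neg (by norm_num)]

theorem exp_mul_log_det_gram (p : ℕ) (E : Type*) [NormedAddCommGroup E] [InnerProductSpace ℝ E]
    [FiniteDimensional ℝ E] [MeasurableSpace E] [BorelSpace E] (hp : p ≤ Module.finrank ℝ E)
    {s : ℝ} (hs : -(1 / 2) < s) :
    Integrable (fun v : Fin p → E => Real.exp (s * Real.log (gram ℝ v).det))
      (Measure.pi fun _ : Fin p => stdGaussian E) ∧
    mgf (fun v : Fin p → E => Real.log (gram ℝ v).det)
      (Measure.pi fun _ : Fin p => stdGaussian E) s =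
      ∏ k ∈ Finset.range p, chiSqMoment (Module.finrank ℝ E - k) s := by
  have hm : Measurable fun v : Fin p → E => Real.exp (s * Real.log (gram ℝ v).det) :=
    Real.measurable_exp.comp
      ((Real.measurable_log.comp continuous_det_gram.measurable).const_mul s)
  have h : ∫⁻ v, ENNReal.ofReal (Real.exp (s * Real.log (gram ℝ v).det))
      ∂(Measure.pi fun _ : Fin p => stdGaussian E) =
      ENNReal.ofReal (∏ k ∈ Finset.range p, chiSqMoment (Module.finrank ℝ E - k) s) := by
    rw [← lintegral_det_gram_rpow hs p E hp]
    refine lintegral_congr_ae ?_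
    filter_upwards [det_gram_pos_ae p E hp] with v hv
    rw [ENNReal.ofReal_rpow_of_pos hv, Real.rpow_def_of_pos hv, mul_comm]
  have hnn : 0 ≤ᵐ[Measure.pi fun _ : Fin p => stdGaussian E]
      fun v : Fin p → E => Real.exp (s * Real.log (gram ℝ v).det) :=
    ae_of_all _ fun v => (Real.exp_pos _).le
  refine ⟨(lintegral_ofReal_ne_top_iff_integrable hm.aestronglyMeasurable hnn).1
    (h ▸ ENNReal.ofReal_ne_top), ?_⟩
  rw [mgf, integral_eq_lintegral_of_nonneg_ae hnn hm.aestronglyMeasurable, h,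
    ENNReal.toReal_ofReal]
  refine Finset.prod_nonneg fun k hk => (chiSqMoment_pos ?_ hs).le
  have := Finset.mem_range.1 hk
  omega

theorem exists_whitening {p : ℕ} {S : Matrix (Fin p) (Fin p) ℝ} (hS : S.PosDef) :
    ∃ B : Matrix (Fin p) (Fin p) ℝ, B * S * Bᵀ = 1 := by
  obtain ⟨y, hy⟩ := CStarAlgebra.nonneg_iff_eq_star_mul_self.mp hS.posSemidef.nonneg
  have hy' : S = yᵀ * y := by rw [hy, star_eq_conjTranspose, conjTranspose_eq_transpose_of_trivial]
  have hu : IsUnit y.det := by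
    have := hS.det_pos
    rw [hy', det_mul, det_transpose] at this
    exact isUnit_iff_ne_zero.2 fun h => by simp [h] at this
  refine ⟨(y⁻¹)ᵀ, ?_⟩
  rw [hy', transpose_transpose, ← mul_assoc, ← transpose_mul, mul_nonsing_inv _ hu,
    transpose_one, one_mul, mul_nonsing_inv _ hu]

/-- The hyperplane of vectors with vanishing coordinate sum. -/
noncomputable abbrev centeredSpace (n : ℕ) : Submodule ℝ (EuclideanSpace ℝ (Fin (n + 1))) :=
  (Submodule.span ℝ {WithLp.toLp 2 fun _ : Fin (n + 1) => (1 : ℝ)})ᗮ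

theorem finrank_centeredSpace (n : ℕ) : Module.finrank ℝ (centeredSpace n) = n := by
  have h := Submodule.finrank_add_finrank_orthogonal
    (Submodule.span ℝ {(WithLp.toLp 2 fun _ : Fin (n + 1) => (1 : ℝ))})
  rw [finrank_span_singleton fun h => by simpa using congrArg (fun v => v.ofLp 0) h,
    finrank_euclideanSpace_fin] at h
  change 1 + Module.finrank ℝ (centeredSpace n) = n + 1 at h
  omega

theorem centeredSpace_proj_apply {n : ℕ} (y : EuclideanSpace ℝ (Fin (n + 1))) (k : Fin (n + 1)) :
    ((centeredSpace n).orthogonalProjectionOnto y : EuclideanSpace ℝ (Fin (n + 1))) k =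
      y k - (∑ l, y l) / (n + 1) := by
  have := Submodule.starProjection_orthogonal_val
    (K := Submodule.span ℝ {(WithLp.toLp 2 fun _ : Fin (n + 1) => (1 : ℝ))}) y
  rw [Submodule.starProjection_singleton] at this
  rw [← Submodule.starProjection_apply, this]
  simp [EuclideanSpace.real_norm_sq_eq, PiLp.inner_apply]

theorem sum_eq_zero_of_mem_centeredSpace {n : ℕ} (t : centeredSpace n) :
    ∑ k, (t : EuclideanSpace ℝ (Fin (n + 1))) k = 0 := by
  have := Submodule.mem_orthogonal_singleton_iff_inner_right.1 t.2
  simpa [PiLp.inner_apply] using this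

/-- The columns of the sample after the linear change of variables `B` and centering. -/
noncomputable def whitenedSample {n p : ℕ} (B : Matrix (Fin p) (Fin p) ℝ)
    (X : Fin (n + 1) → Fin p → ℝ) (j : Fin p) : centeredSpace n :=
  (centeredSpace n).orthogonalProjectionOnto (WithLp.toLp 2 fun k => (B *ᵥ X k) j)

theorem measurable_whitenedSample {n p : ℕ} (B : Matrix (Fin p) (Fin p) ℝ) :
    Measurable (whitenedSample B : (Fin (n + 1) → Fin p → ℝ) → Fin p → centeredSpace n) := by
  refine Continuous.measurable (continuous_pi fun j => ?_)
  unfold whitenedSample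
  simp only [mulVec, dotProduct]
  fun_prop

theorem gram_whitenedSample {n p : ℕ} (hn : n ≠ 0) (B : Matrix (Fin p) (Fin p) ℝ)
    (X : Fin (n + 1) → Fin p → ℝ) :
    gram ℝ (whitenedSample B X) = (n : ℝ) • (B * sampleCov X * Bᵀ) := by
  have hn' : (n : ℝ) ≠ 0 := by exact_mod_cast hn
  set C : Matrix (Fin (n + 1)) (Fin p) ℝ :=
    Matrix.of fun k a => X k a - (∑ l, X l a) / (n + 1) with hC
  have hcov : (n : ℝ) • sampleCov X = Cᵀ * C := by
    ext i j
    simp [sampleCov, hC, mul_apply, hn']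
  have hw : ∀ k j, (whitenedSample B X j : EuclideanSpace ℝ (Fin (n + 1))) k = (C * Bᵀ) k j := by
    intro k j
    rw [whitenedSample, centeredSpace_proj_apply]
    simp only [mulVec, dotProduct, mul_apply, hC, of_apply, transpose_apply, sub_mul,
      Finset.sum_sub_distrib]
    rw [Finset.sum_comm, Finset.sum_div]
    congr 1
    · exact Finset.sum_congr rfl fun a _ => mul_comm _ _
    · refine Finset.sum_congr rfl fun a _ => ?_
      rw [← Finset.mul_sum]
      ring
  rw [← smul_mul_assoc, ← mul_smul_comm, hcov,
    show B * (Cᵀ * C) * Bᵀ = (C * Bᵀ)ᵀ * (C * Bᵀ) by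
      rw [transpose_mul, transpose_transpose]; simp only [Matrix.mul_assoc]]
  ext i j
  rw [gram_apply, Submodule.coe_inner, PiLp.inner_apply, mul_apply]
  refine Finset.sum_congr rfl fun k _ => ?_
  rw [hw, hw, transpose_apply]
  simp [mul_comm]

theorem log_det_sampleCov {n p : ℕ} (hn : n ≠ 0) {S B : Matrix (Fin p) (Fin p) ℝ}
    (hS : S.PosDef) (hB : B * S * Bᵀ = 1) {X : Fin (n + 1) → Fin p → ℝ}
    (hX : 0 < (gram ℝ (whitenedSample B X)).det) :
    Real.log (sampleCov X).det =
      Real.log (gram ℝ (whitenedSample B X)).det + Real.log S.det - p * Real.log n := by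
  have hn' : (n : ℝ) ≠ 0 := by exact_mod_cast hn
  have hdet : B.det * S.det * B.det = 1 := by
    simpa [det_mul] using congrArg Matrix.det hB
  have hG : (gram ℝ (whitenedSample B X)).det = n ^ p * (B.det * (sampleCov X).det * B.det) := by
    rw [gram_whitenedSample hn, det_smul, det_mul, det_mul, det_transpose, Fintype.card_fin]
  have key : (gram ℝ (whitenedSample B X)).det * S.det = n ^ p * (sampleCov X).det := by
    rw [hG]
    linear_combination (n ^ p * (sampleCov X).det) * hdet
  have hc : (sampleCov X).det ≠ 0 := fun h => by
    rw [h, mul_zero] at key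
    exact (mul_pos hX hS.det_pos).ne' key
  rw [← Real.log_mul hX.ne' hS.det_pos.ne', key, Real.log_mul (pow_ne_zero _ hn') hc, Real.log_pow]
  ring

theorem integral_cexp_of_isMvGaussian {p : ℕ} {m : Fin p → ℝ} {S : Matrix (Fin p) (Fin p) ℝ}
    {ν : Measure (Fin p → ℝ)} (hν : IsMvGaussian m S ν) {l : Fin p → ℝ}
    (hl : 0 ≤ l ⬝ᵥ (S *ᵥ l)) :
    ∫ x, Complex.exp (((l ⬝ᵥ x : ℝ) : ℂ) * Complex.I) ∂ν =
      Complex.exp ((l ⬝ᵥ m : ℝ) * Complex.I - (l ⬝ᵥ (S *ᵥ l) : ℝ) / 2) := by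
  have h := congrArg (fun μ => charFun μ 1) (hν.2 l)
  simp only [charFun_gaussianReal, Real.coe_toNNReal _ hl] at h
  have hm : Measurable fun x : Fin p → ℝ => ∑ i, l i * x i :=
    Finset.measurable_fun_sum _ fun i _ => (measurable_pi_apply i).const_mul _
  rw [charFun_apply_real, integral_map hm.aemeasurable (by fun_prop)] at h
  simpa [dotProduct] using h

theorem map_whitenedSample {n p : ℕ} {m : Fin p → ℝ} {S B : Matrix (Fin p) (Fin p) ℝ}
    {ν : Measure (Fin p → ℝ)} (hν : IsMvGaussian m S ν) (hB : B * S * Bᵀ = 1) :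
    (Measure.pi fun _ : Fin (n + 1) => ν).map (whitenedSample B) =
      Measure.pi fun _ : Fin p => stdGaussian (centeredSpace n) := by
  have := hν.1
  have : IsProbabilityMeasure
      ((Measure.pi fun _ : Fin (n + 1) => ν).map (whitenedSample (n := n) B)) :=
    Measure.isProbabilityMeasure_map (measurable_whitenedSample B).aemeasurable
  refine Measure.ext_of_charFunDual ?_
  ext L
  set t : Fin p → centeredSpace n := fun j =>
    (InnerProductSpace.toDual ℝ _).symm (L.comp (.single ℝ (fun _ => centeredSpace n) j)) with ht
  set w : Fin (n + 1) → Fin p → ℝ := fun k j => (t j : EuclideanSpace ℝ (Fin (n + 1))) k with hw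
  have hL : ∀ X : Fin (n + 1) → Fin p → ℝ,
      L (whitenedSample B X) = ∑ k, (w k ᵥ* B) ⬝ᵥ X k := by
    intro X
    calc L (whitenedSample B X) = ∑ j, inner ℝ (t j) (whitenedSample B X j) := by
          rw [← L.sum_comp_single]
          refine Finset.sum_congr rfl fun j _ => ?_
          rw [ht, InnerProductSpace.toDual_symm_apply]
        _ = ∑ j, ∑ k, w k j * (B *ᵥ X k) j := by
          refine Finset.sum_congr rfl fun j _ => ?_
          rw [whitenedSample, Submodule.inner_orthogonalProjectionOnto_eq_of_mem_left,
            PiLp.inner_apply]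
          exact Finset.sum_congr rfl fun k _ => by simp [hw, mul_comm]
        _ = _ := by
          rw [Finset.sum_comm]
          refine Finset.sum_congr rfl fun k _ => ?_
          rw [← dotProduct_mulVec]
          rfl
  have hquad : ∀ k, (w k ᵥ* B) ⬝ᵥ (S *ᵥ (w k ᵥ* B)) = w k ⬝ᵥ w k := by
    intro k
    rw [← dotProduct_mulVec, ← mulVec_transpose, mulVec_mulVec, mulVec_mulVec, hB,
      one_mulVec]
  have hmean : ∑ k, (w k ᵥ* B) ⬝ᵥ m = 0 := by
    simp only [← dotProduct_mulVec]
    simp only [dotProduct]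
    rw [Finset.sum_comm]
    refine Finset.sum_eq_zero fun j _ => ?_
    rw [← Finset.sum_mul, sum_eq_zero_of_mem_centeredSpace, zero_mul]
  have hnorm : ∀ j, ‖L.comp (.single ℝ (fun _ => centeredSpace n) j)‖ ^ 2 = ∑ k, w k j ^ 2 := by
    intro j
    rw [← (InnerProductSpace.toDual ℝ (centeredSpace n)).symm.norm_map, Submodule.coe_norm,
      EuclideanSpace.real_norm_sq_eq]
  rw [charFunDual_apply, integral_map (measurable_whitenedSample B).aemeasurable (by fun_prop),
    charFunDual_pi]
  simp only [charFunDual_stdGaussian, hL, ← Complex.ofReal_pow, hnorm]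
  simp only [Complex.ofReal_sum, Finset.sum_mul, Complex.exp_sum]
  rw [integral_fintype_prod_eq_prod (f := fun k x =>
    Complex.exp ((((w k ᵥ* B) ⬝ᵥ x : ℝ) : ℂ) * Complex.I))]
  rw [Finset.prod_congr rfl fun k _ => integral_cexp_of_isMvGaussian hν
    (by rw [hquad]; exact Finset.sum_nonneg fun j _ => mul_self_nonneg _)]
  simp only [hquad, ← Complex.exp_sum, Finset.sum_sub_distrib]
  rw [← Finset.sum_mul, ← Complex.ofReal_sum, hmean, ← Finset.sum_div, ← Finset.sum_div,
    Finset.sum_neg_distrib, Finset.sum_comm (γ := Fin p)]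
  simp [dotProduct, neg_div, sq]

theorem analyticAt_log_Gamma {x : ℝ} (hx : 0 < x) :
    AnalyticAt ℝ (fun y : ℝ => Real.log (Real.Gamma y)) x := by
  have hc : AnalyticAt ℂ Complex.Gamma (x : ℂ) := by
    have hopen : IsOpen {z : ℂ | 0 < z.re} := isOpen_lt continuous_const Complex.continuous_re
    refine DifferentiableOn.analyticAt (s := {z : ℂ | 0 < z.re}) (fun z hz => ?_)
      (hopen.mem_nhds (by simpa using hx))
    refine (Complex.differentiableAt_Gamma z fun k hk => ?_).differentiableWithinAt
    rw [hk] at hz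
    simp only [Set.mem_ofPred_eq, Complex.neg_re, Complex.natCast_re] at hz
    linarith [k.cast_nonneg (α := ℝ)]
  have hr : AnalyticAt ℝ Real.Gamma x := hc.re_ofReal
  exact hr.log (Real.Gamma_pos_of_pos hx)

theorem differentiableAt_digamma {x : ℝ} (hx : 0 < x) : DifferentiableAt ℝ digamma x :=
  (analyticAt_log_Gamma hx).deriv.differentiableAt

theorem hasDerivAt_log_Gamma {x : ℝ} (hx : 0 < x) :
    HasDerivAt (fun y : ℝ => Real.log (Real.Gamma y)) (digamma x) x :=
  (analyticAt_log_Gamma hx).differentiableAt.hasDerivAt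

section LogDetGram

variable (p : ℕ) (E : Type*) [NormedAddCommGroup E] [InnerProductSpace ℝ E]
  [FiniteDimensional ℝ E] [MeasurableSpace E] [BorelSpace E]

theorem zero_mem_interior_integrableExpSet_log_det_gram (hp : p ≤ Module.finrank ℝ E) :
    0 ∈ interior (integrableExpSet (fun v : Fin p → E => Real.log (gram ℝ v).det)
      (Measure.pi fun _ : Fin p => stdGaussian E)) := by
  rw [mem_interior_iff_mem_nhds]
  filter_upwards [Ioi_mem_nhds (show -(1 / 2 : ℝ) < 0 by norm_num)] with s hs
  exact (exp_mul_log_det_gram p E hp hs).1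

theorem cgf_log_det_gram (hp : p ≤ Module.finrank ℝ E) {s : ℝ} (hs : -(1 / 2) < s) :
    cgf (fun v : Fin p → E => Real.log (gram ℝ v).det)
      (Measure.pi fun _ : Fin p => stdGaussian E) s =
      ∑ k ∈ Finset.Icc 1 p, (s * Real.log 2 +
        Real.log (Real.Gamma (((Module.finrank ℝ E : ℝ) - k + 1) / 2 + s)) -
        Real.log (Real.Gamma (((Module.finrank ℝ E : ℝ) - k + 1) / 2))) := by
  have hk1 : ∀ k ∈ Finset.range p, 1 ≤ Module.finrank ℝ E - k := fun k hk => by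
    have := Finset.mem_range.1 hk
    omega
  rw [cgf, (exp_mul_log_det_gram p E hp hs).2,
    Real.log_prod fun k hk => (chiSqMoment_pos (hk1 k hk) hs).ne',
    ← Finset.Ico_add_one_right_eq_Icc, Finset.sum_Ico_eq_sum_range, Nat.add_sub_cancel]
  refine Finset.sum_congr rfl fun k hk => ?_
  have hk' := hk1 k hk
  have hc : ((Module.finrank ℝ E - k : ℕ) : ℝ) = (Module.finrank ℝ E : ℝ) - (1 + k : ℕ) + 1 := by
    rw [Nat.cast_sub (by omega)]
    push_cast
    ring
  have hpos : (1 : ℝ) ≤ ((Module.finrank ℝ E - k : ℕ) : ℝ) := by exact_mod_cast hk'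
  rw [← hc, chiSqMoment, Real.log_div (mul_pos (by positivity)
    (Real.Gamma_pos_of_pos (by linarith))).ne' (Real.Gamma_pos_of_pos (by linarith)).ne',
    Real.log_mul (by positivity) (Real.Gamma_pos_of_pos (by linarith)).ne',
    Real.log_rpow two_pos]

theorem hasDerivAt_cgf_log_det_gram (hp : p ≤ Module.finrank ℝ E) {s : ℝ} (hs : -(1 / 2) < s) :
    HasDerivAt (cgf (fun v : Fin p → E => Real.log (gram ℝ v).det)
      (Measure.pi fun _ : Fin p => stdGaussian E))
      (∑ k ∈ Finset.Icc 1 p, (Real.log 2 +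
        digamma (((Module.finrank ℝ E : ℝ) - k + 1) / 2 + s))) s := by
  have hev : (cgf (fun v : Fin p → E => Real.log (gram ℝ v).det)
      (Measure.pi fun _ : Fin p => stdGaussian E)) =ᶠ[nhds s] _ :=
    Filter.mem_of_superset (Ioi_mem_nhds hs) fun t ht => cgf_log_det_gram p E hp ht
  refine HasDerivAt.congr_of_eventuallyEq (HasDerivAt.fun_sum fun k hk => ?_) hev
  have hk' : (k : ℝ) ≤ Module.finrank ℝ E := by
    exact_mod_cast (Finset.mem_Icc.1 hk).2.trans hp
  have h := (hasDerivAt_log_Gamma (x := ((Module.finrank ℝ E : ℝ) - k + 1) / 2 + s)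
    (by linarith)).comp_const_add _ s
  exact ((hasDerivAt_mul_const (Real.log 2)).fun_add h).sub_const _

theorem integral_log_det_gram (hp : p ≤ Module.finrank ℝ E) :
    ∫ v, Real.log (gram ℝ v).det ∂(Measure.pi fun _ : Fin p => stdGaussian E) =
      ∑ k ∈ Finset.Icc 1 p, (Real.log 2 + digamma (((Module.finrank ℝ E : ℝ) - k + 1) / 2)) := by
  have h := deriv_cgf_zero (zero_mem_interior_integrableExpSet_log_det_gram p E hp)
  rw [(hasDerivAt_cgf_log_det_gram p E hp (by norm_num)).deriv] at h
  simpa using h.symm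

theorem integral_sq_log_det_gram_sub (hp : p ≤ Module.finrank ℝ E) :
    ∫ v, (Real.log (gram ℝ v).det - ∑ k ∈ Finset.Icc 1 p,
        (Real.log 2 + digamma (((Module.finrank ℝ E : ℝ) - k + 1) / 2))) ^ 2
      ∂(Measure.pi fun _ : Fin p => stdGaussian E) =
      ∑ k ∈ Finset.Icc 1 p, trigamma (((Module.finrank ℝ E : ℝ) - k + 1) / 2) := by
  have h := iteratedDeriv_two_cgf_eq_integral
    (zero_mem_interior_integrableExpSet_log_det_gram p E hp)
  have hev : deriv (cgf (fun v : Fin p → E => Real.log (gram ℝ v).det)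
      (Measure.pi fun _ : Fin p => stdGaussian E)) =ᶠ[nhds 0] _ :=
    Filter.mem_of_superset (Ioi_mem_nhds (show -(1 / 2 : ℝ) < 0 by norm_num)) fun t ht =>
      (hasDerivAt_cgf_log_det_gram p E hp ht).deriv
  have hd : HasDerivAt (fun s => ∑ k ∈ Finset.Icc 1 p, (Real.log 2 +
      digamma (((Module.finrank ℝ E : ℝ) - k + 1) / 2 + s)))
      (∑ k ∈ Finset.Icc 1 p, trigamma (((Module.finrank ℝ E : ℝ) - k + 1) / 2)) 0 := by
    refine HasDerivAt.fun_sum fun k hk => HasDerivAt.const_add _ ?_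
    have hk' : (k : ℝ) ≤ Module.finrank ℝ E := by
      exact_mod_cast (Finset.mem_Icc.1 hk).2.trans hp
    refine HasDerivAt.comp_const_add _ 0 ?_
    rw [add_zero]
    exact (differentiableAt_digamma (by linarith)).hasDerivAt
  rw [iteratedDeriv_succ, iteratedDeriv_one, hev.deriv_eq, hd.deriv, hev.eq_of_nhds] at h
  simpa using h.symm

theorem integrable_log_det_gram (hp : p ≤ Module.finrank ℝ E) :
    Integrable (fun v : Fin p → E => Real.log (gram ℝ v).det)
      (Measure.pi fun _ : Fin p => stdGaussian E) := by
  simpa using integrable_pow_of_mem_interior_integrableExpSet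
    (zero_mem_interior_integrableExpSet_log_det_gram p E hp) 1

end LogDetGram

theorem log_det_sampleCov_sub_tauNP_ae {n p : ℕ} (hp1 : 1 ≤ p) (hpn : p ≤ n) {m : Fin p → ℝ}
    {S B : Matrix (Fin p) (Fin p) ℝ} (hS : S.PosDef) {ν : Measure (Fin p → ℝ)}
    (hν : IsMvGaussian m S ν) (hB : B * S * Bᵀ = 1) :
    ∀ᵐ X ∂(Measure.pi fun _ : Fin (n + 1) => ν),
      Real.log (sampleCov X).det - tauNP n p =
        Real.log (gram ℝ (whitenedSample B X)).det - (∑ k ∈ Finset.Icc 1 p,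
          (Real.log 2 + digamma (((n : ℝ) - k + 1) / 2))) + Real.log S.det := by
  have hn : n ≠ 0 := by omega
  have hpos := det_gram_pos_ae p (centeredSpace n) (by rwa [finrank_centeredSpace])
  rw [← map_whitenedSample hν hB] at hpos
  filter_upwards [ae_of_ae_map (measurable_whitenedSample B).aemeasurable hpos] with X hX
  rw [log_det_sampleCov hn hS hB hX, tauNP, Real.log_div (by exact_mod_cast hn) two_ne_zero]
  simp only [Finset.sum_sub_distrib, Finset.sum_add_distrib, Finset.sum_const, Nat.card_Icc,
    Nat.add_sub_cancel, nsmul_eq_mul]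
  ring

end GramDeterminant

/-- **Unbiasedness and exact risk of `T̂ = log det Σ̂ − τ_{n,p}`**: for an i.i.d. sample
`X₁, …, X_{n+1} ~ N_p(μ, Σ)` with `Σ` positive definite and `p ≤ n`, `T̂` is unbiased for
`log det Σ` and `E(T̂ − log det Σ)² = ∑_{k=1}^p ψ'((n−k+1)/2)`. -/
theorem that_unbiased_and_exact_risk
    (n p : ℕ) (hp1 : 1 ≤ p) (hpn : p ≤ n)
    (m : Fin p → ℝ)
    (S : Matrix (Fin p) (Fin p) ℝ) (hS : S.PosDef)
    (ν : Measure (Fin p → ℝ)) (hν : IsMvGaussian m S ν) :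
    (∫ X, (Real.log (sampleCov X).det - tauNP n p)
        ∂(Measure.pi fun _ : Fin (n + 1) => ν)) = Real.log S.det ∧
    (∫ X, (Real.log (sampleCov X).det - tauNP n p - Real.log S.det) ^ 2
        ∂(Measure.pi fun _ : Fin (n + 1) => ν)) =
      ∑ k ∈ Finset.Icc 1 p, trigamma (((n : ℝ) - k + 1) / 2) := by
  have hn : Module.finrank ℝ (centeredSpace n) = n := finrank_centeredSpace n
  have hp : p ≤ Module.finrank ℝ (centeredSpace n) := hpn.trans_eq hn.symm
  obtain ⟨B, hB⟩ := exists_whitening hS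
  have hae := log_det_sampleCov_sub_tauNP_ae hp1 hpn hS hν hB
  have hmean := integral_log_det_gram p (centeredSpace n) hp
  have hrisk := integral_sq_log_det_gram_sub p (centeredSpace n) hp
  have hmeas : Measurable fun v : Fin p → centeredSpace n => Real.log (gram ℝ v).det :=
    Real.measurable_log.comp continuous_det_gram.measurable
  rw [hn] at hmean hrisk
  constructor
  · rw [integral_congr_ae hae, ← integral_map (measurable_whitenedSample B).aemeasurable
      (f := fun v => Real.log (gram ℝ v).det - (∑ k ∈ Finset.Icc 1 p,
          (Real.log 2 + digamma (((n : ℝ) - k + 1) / 2))) + Real.log S.det)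
      ((hmeas.sub_const _).add_const _).aestronglyMeasurable, map_whitenedSample hν hB,
      integral_add (by exact (integrable_log_det_gram p _ hp).sub (integrable_const _))
        (integrable_const _),
      integral_sub (integrable_log_det_gram p _ hp) (integrable_const _), hmean]
    simp
  · rw [← hrisk, ← map_whitenedSample hν hB,
      integral_map (measurable_whitenedSample B).aemeasurable
        ((hmeas.sub_const _).pow_const 2).aestronglyMeasurable]
    refine integral_congr_ae ?_
    filter_upwards [hae] with X hX
    rw [hX, add_sub_cancel_right]
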